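/- Let p = (x₁,x₂,x₃,x₁₂,x₁₃,x₂₃,x₁₂₃) ∈ (−1,1)⁷ satisfy F(p) = 0, G(p) ≠ 0, and x₁² + x₂² + x₁₂² − 2x₁x₂x₁₂ < 1. Then the symmetric 4×4 real matrix g₃(p) is positive definite. -/

import Mathlib

noncomputable section

/-- Coordinates on `ℝ⁷` are `p = (x₁,x₂,x₃,x₁₂,x₁₃,x₂₃,x₁₂₃)`, indexed `0,…,6`. -/
abbrev R7 := Fin 7 → ℝ

/-- The symmetric 4×4 matrix `g₃(p)`. -/
def g3Mat (p : R7) : Matrix (Fin 4) (Fin 4) ℝ :=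
  !![1,    p 0,                  p 1,                  p 2;
     p 0,  1,                    2 * p 0 * p 1 - p 3,  2 * p 0 * p 2 - p 4;
     p 1,  2 * p 0 * p 1 - p 3,  1,                    2 * p 1 * p 2 - p 5;
     p 2,  2 * p 0 * p 2 - p 4,  2 * p 1 * p 2 - p 5,  1]

/-- `G = 2x₁x₂x₃ + x₁₂₃ − x₃x₁₂ − x₁x₂₃ − x₂x₁₃`. -/
def G (p : R7) : ℝ :=
  2 * p 0 * p 1 * p 2 + p 6 - p 2 * p 3 - p 0 * p 5 - p 1 * p 4

/-- The Aut(F₃)-invariant polynomial `F`. -/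
def F (p : R7) : ℝ :=
  p 0 ^ 2 + p 1 ^ 2 + p 2 ^ 2 + p 3 ^ 2 + p 4 ^ 2 + p 5 ^ 2 + p 6 ^ 2
    + 4 * p 0 * p 1 * p 2 * p 6
    - 2 * p 0 * p 1 * p 3 - 2 * p 0 * p 2 * p 4 - 2 * p 0 * p 5 * p 6
    - 2 * p 1 * p 2 * p 5 - 2 * p 1 * p 4 * p 6 - 2 * p 2 * p 3 * p 6
    + 2 * p 3 * p 4 * p 5 - 1

/-- Sylvester's criterion in scalar form, after clearing denominators. -/
lemma quad_pos (a b c d e f g w x y z : ℝ)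
    (h1 : 0 < 1 - a ^ 2)
    (h2 : 0 < 1 - (a ^ 2 + b ^ 2 + d ^ 2 - 2 * a * b * d))
    (hF : a ^ 2 + b ^ 2 + c ^ 2 + d ^ 2 + e ^ 2 + f ^ 2 + g ^ 2
      + 4 * a * b * c * g - 2 * a * b * d - 2 * a * c * e - 2 * a * f * g
      - 2 * b * c * f - 2 * b * e * g - 2 * c * d * g + 2 * d * e * f - 1 = 0)
    (hG : 2 * a * b * c + g - c * d - a * f - b * e ≠ 0)
    (hv : ¬ (w = 0 ∧ x = 0 ∧ y = 0 ∧ z = 0)) :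
    0 < w ^ 2 + x ^ 2 + y ^ 2 + z ^ 2 + 2 * a * w * x + 2 * b * w * y + 2 * c * w * z
      + 2 * (2 * a * b - d) * x * y + 2 * (2 * a * c - e) * x * z
      + 2 * (2 * b * c - f) * y * z := by
  by_contra hQ
  have hQ' := not_lt.mp hQ
  obtain ⟨D2, hD2⟩ : ∃ t, t = 1 - a ^ 2 := ⟨_, rfl⟩
  obtain ⟨D3, hD3⟩ : ∃ t, t = 1 - (a ^ 2 + b ^ 2 + d ^ 2 - 2 * a * b * d) := ⟨_, rfl⟩
  obtain ⟨K, hK⟩ : ∃ t, t = 2 * a * b * c + g - c * d - a * f - b * e := ⟨_, rfl⟩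
  obtain ⟨L1, hL1⟩ : ∃ t, t = w + a * x + b * y + c * z := ⟨_, rfl⟩
  obtain ⟨L2, hL2⟩ : ∃ t, t = D2 * x + (a * b - d) * y + (a * c - e) * z := ⟨_, rfl⟩
  obtain ⟨T, hT⟩ : ∃ t, t = D2 * (b * c - f) - (a * b - d) * (a * c - e) := ⟨_, rfl⟩
  have key : D2 * D3 * (w ^ 2 + x ^ 2 + y ^ 2 + z ^ 2 + 2 * a * w * x + 2 * b * w * y
      + 2 * c * w * z + 2 * (2 * a * b - d) * x * y + 2 * (2 * a * c - e) * x * z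
      + 2 * (2 * b * c - f) * y * z)
      = D2 * D3 * L1 ^ 2 + D3 * L2 ^ 2 + (D3 * y + T * z) ^ 2 + D2 * (K * z) ^ 2 := by
    rw [hL1, hL2, hT, hK, hD3, hD2]
    linear_combination (-(1 - a ^ 2) * z ^ 2) * hF
  rw [← hD2] at h1
  rw [← hD3] at h2
  rw [← hK] at hG
  have hn : D2 * D3 * L1 ^ 2 + D3 * L2 ^ 2 + (D3 * y + T * z) ^ 2 + D2 * (K * z) ^ 2 ≤ 0 := by
    rw [← key]
    exact mul_nonpos_of_nonneg_of_nonpos (by positivity) hQ'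
  have n1 : 0 ≤ D2 * D3 * L1 ^ 2 := by positivity
  have n2 : 0 ≤ D3 * L2 ^ 2 := by positivity
  have n3 : 0 ≤ (D3 * y + T * z) ^ 2 := by positivity
  have n4 : 0 ≤ D2 * (K * z) ^ 2 := by positivity
  have e1 : D2 * D3 * L1 ^ 2 = 0 := by linarith
  have e2 : D3 * L2 ^ 2 = 0 := by linarith
  have e3 : (D3 * y + T * z) ^ 2 = 0 := by linarith
  have e4 : D2 * (K * z) ^ 2 = 0 := by linarith
  have hz : z = 0 := by simpa [h1.ne', hG] using e4
  have hy : y = 0 := by simpa [hz, h2.ne'] using e3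
  have hx : x = 0 := by simpa [hL2, hy, hz, h2.ne', h1.ne'] using e2
  have hw : w = 0 := by simpa [hL1, hx, hy, hz, h2.ne', h1.ne'] using e1
  exact hv ⟨hw, hx, hy, hz⟩

theorem stmt17 (p : R7) (hbox : ∀ i, p i ∈ Set.Ioo (-1 : ℝ) 1)
    (hF : F p = 0) (hG : G p ≠ 0)
    (hE : p 0 ^ 2 + p 1 ^ 2 + p 3 ^ 2 - 2 * p 0 * p 1 * p 3 < 1) :
    (g3Mat p).PosDef := by
  apply Matrix.PosDef.of_dotProduct_mulVec_pos
  · ext i j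
    fin_cases i <;> fin_cases j <;> simp [g3Mat]
  · intro v hv
    have h0 := hbox 0
    have h1 : 0 < 1 - p 0 ^ 2 := by nlinarith [h0.1, h0.2]
    have h := quad_pos (p 0) (p 1) (p 2) (p 3) (p 4) (p 5) (p 6) (v 0) (v 1) (v 2) (v 3)
      h1 (by linarith) hF hG (by
        rintro ⟨a0, a1, a2, a3⟩
        apply hv
        ext i
        fin_cases i <;> simp [a0, a1, a2, a3])
    refine lt_of_lt_of_eq h ?_
    simp [g3Mat, Matrix.mulVec, dotProduct, Fin.sum_univ_four]
    ring

end
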